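/- arXiv:2312.05825 — 2 statements merged into one kernel-verified Lean document; each statement's English description precedes it below -/
import Mathlib

section
/- Asymptotic weak convergence to a minimizer: let H be a real Hilbert space and I : H → ℝ ∪ {+∞} proper, convex and lower semicontinuous, and assume I attains its minimum on H. Let u : [0,∞) → H be continuous on [0,∞), locally Lipschitz on (0,∞), and satisfy −u'(t) ∈ ∂I(u(t)) for a.e. t > 0. Then there exists u* ∈ H with I(u*) = min_H I such that u(t) converges weakly to u* in H as t → ∞. -/
open MeasureTheory Filter Topology Set
open scoped RealInnerProductSpace

/-- The subdifferential of an `EReal`-valued functional `I` on a real inner product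
space `H` at a point `u`:
`∂I(u) = {v ∈ H : I(w) ≥ I(u) + ⟨v, w − u⟩ for all w ∈ H}`. -/
def subdiff {H : Type*} [NormedAddCommGroup H] [InnerProductSpace ℝ H]
    (I : H → EReal) (u : H) : Set H :=
  {v | ∀ w : H, I u + ((⟪v, w - u⟫ : ℝ) : EReal) ≤ I w}

/-- Convexity of an `EReal`-valued functional. -/
def ERealConvex {H : Type*} [NormedAddCommGroup H] [InnerProductSpace ℝ H]
    (I : H → EReal) : Prop :=
  ∀ u v : H, ∀ a b : ℝ, 0 ≤ a → 0 ≤ b → a + b = 1 →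
    I (a • u + b • v) ≤ (a : EReal) * I u + (b : EReal) * I v

variable {H : Type*} [NormedAddCommGroup H] [InnerProductSpace ℝ H] [CompleteSpace H]

/-- An absolutely continuous function on `[a, b]` with derivative at most `c` almost everywhere
increases by at most `c * (b - a)`. -/
theorem AbsolutelyContinuousOnInterval.sub_le_of_ae_hasDerivAt_le {g : ℝ → ℝ} {a b c : ℝ}
    (hab : a ≤ b) (hg : AbsolutelyContinuousOnInterval g a b)
    (hd : ∀ᵐ t, t ∈ Ioo a b → ∃ d ≤ c, HasDerivAt g d t) :
    g b - g a ≤ c * (b - a) := by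
  rw [← hg.integral_deriv_eq_sub]
  have hle : deriv g ≤ᵐ[volume.restrict (Icc a b)] fun _ => c := by
    rw [← restrict_Ioo_eq_restrict_Icc]
    refine (ae_restrict_iff' measurableSet_Ioo).2 ?_
    filter_upwards [hd] with t ht hmem
    obtain ⟨d, hdc, hder⟩ := ht hmem
    exact hder.deriv ▸ hdc
  calc ∫ x in a..b, deriv g x ≤ ∫ _ in a..b, c :=
        intervalIntegral.integral_mono_ae_restrict hab hg.intervalIntegrable_deriv
          intervalIntegrable_const hle
    _ = c * (b - a) := by simp [mul_comm]

section

variable {E : Type*} [NormedAddCommGroup E] [InnerProductSpace ℝ E]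

theorem LipschitzOnWith.norm_sq_sub_norm_sq_le {f : ℝ → E} {a b c : ℝ} {K : NNReal}
    (hab : a ≤ b) (hf : LipschitzOnWith K f (Icc a b))
    (hd : ∀ᵐ t, t ∈ Ioo a b → ∃ d, HasDerivAt f d t ∧ ⟪d, f t⟫ ≤ c) :
    ‖f b‖ ^ 2 - ‖f a‖ ^ 2 ≤ 2 * c * (b - a) := by
  have hn : AbsolutelyContinuousOnInterval (fun t => ‖f t‖) a b := by
    refine LipschitzOnWith.absolutelyContinuousOnInterval (K := K) ?_
    rw [uIcc_of_le hab]
    simpa [Function.comp_def] using! lipschitzWith_one_norm.comp_lipschitzOnWith hf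
  have hsq : AbsolutelyContinuousOnInterval (fun t => ‖f t‖ ^ 2) a b := by
    simpa only [sq] using hn.fun_mul hn
  refine hsq.sub_le_of_ae_hasDerivAt_le hab ?_
  filter_upwards [hd] with t ht hmem
  obtain ⟨d, hder, hle⟩ := ht hmem
  refine ⟨_, ?_, hder.norm_sq⟩
  rw [real_inner_comm]
  linarith

theorem ne_top_of_mem_subdiff {I : E → EReal} (hproper : ∃ x, I x ≠ ⊤) {p v : E}
    (hv : v ∈ subdiff I p) : I p ≠ ⊤ := by
  obtain ⟨y, hy⟩ := hproper
  intro h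
  have := hv y
  rw [h, EReal.top_add_coe] at this
  exact hy (top_le_iff.1 this)

theorem inner_le_of_mem_subdiff {I : E → EReal} {p w v : E} {r s : ℝ} (hp : (r : EReal) ≤ I p)
    (hw : I w ≤ s) (hv : v ∈ subdiff I p) : ⟪v, w - p⟫ ≤ s - r := by
  have h : (r : EReal) + (⟪v, w - p⟫ : ℝ) ≤ s := (add_le_add_left hp _).trans ((hv w).trans hw)
  have h' : r + ⟪v, w - p⟫ ≤ s := by exact_mod_cast h
  linarith

/-- The subdifferential is a monotone operator. -/
theorem inner_sub_nonneg_of_mem_subdiff {I : E → EReal} (hbot : ∀ x, I x ≠ ⊥)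
    (hproper : ∃ x, I x ≠ ⊤) {p q v w : E} (hv : v ∈ subdiff I p) (hw : w ∈ subdiff I q) :
    0 ≤ ⟪v - w, p - q⟫ := by
  have hp := EReal.coe_toReal (ne_top_of_mem_subdiff hproper hv) (hbot p)
  have hq := EReal.coe_toReal (ne_top_of_mem_subdiff hproper hw) (hbot q)
  have h₁ := inner_le_of_mem_subdiff hp.le hq.ge hv
  have h₂ := inner_le_of_mem_subdiff hq.le hp.ge hw
  rw [← neg_sub p q, inner_neg_right] at h₁
  rw [inner_sub_left]
  linarith

theorem ERealConvex.convex_sublevel {I : E → EReal} (hconv : ERealConvex I) (c : ℝ) :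
    Convex ℝ {x | I x ≤ c} := by
  intro x hx y hy a b ha hb hab
  have ha' : (0 : EReal) ≤ a := by exact_mod_cast ha
  have hb' : (0 : EReal) ≤ b := by exact_mod_cast hb
  calc I (a • x + b • y) ≤ a * I x + b * I y := hconv x y a b ha hb hab
    _ ≤ (a : EReal) * c + (b : EReal) * c :=
        add_le_add (mul_le_mul_of_nonneg_left hx ha') (mul_le_mul_of_nonneg_left hy hb')
    _ = c := by
        norm_cast
        rw [← add_mul, hab, one_mul]

/-- A closed convex set contains the weak limits of functions approaching it in norm. -/
theorem Convex.mem_of_tendsto_weak {α : Type*} {l : Filter α} [l.NeBot] {C : Set E}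
    (hC : Convex ℝ C) (hC' : IsClosed C) {u : α → E} {x : E}
    (hu : ∀ f : StrongDual ℝ E, Tendsto (fun t => f (u t)) l (𝓝 (f x)))
    (happrox : ∀ δ > 0, ∀ᶠ t in l, ∃ p ∈ C, ‖u t - p‖ ≤ δ) : x ∈ C := by
  by_contra hx
  obtain ⟨f, c, hfC, hfx⟩ := geometric_hahn_banach_closed_point hC hC' hx
  set δ := (f x - c) / (2 * (‖f‖ + 1)) with hδ
  have hpos : 0 < f x - c := by linarith
  have hmid : (f x + c) / 2 < f x := by linarith
  obtain ⟨t, ⟨p, hp, htp⟩, ht⟩ :=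
    ((happrox δ (by positivity)).and ((hu f).eventually (lt_mem_nhds hmid))).exists
  have h₁ : f (u t) - f p ≤ ‖f‖ * δ := by
    rw [← map_sub]
    exact (le_abs_self _).trans ((f.le_opNorm _).trans (by gcongr))
  have h₂ : (‖f‖ + 1) * δ = (f x - c) / 2 := by
    rw [hδ]
    field_simp
  have h₃ : 0 ≤ δ := (norm_nonneg _).trans htp
  have := hfC p hp
  linarith

/-- Bounded functions into a Hilbert space converge weakly along ultrafilters. -/
theorem Ultrafilter.exists_tendsto_inner [CompleteSpace E] {α : Type*} (l : Ultrafilter α)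
    {u : α → E} {R : ℝ} (hu : ∀ᶠ t in l, ‖u t‖ ≤ R) :
    ∃ x : E, ∀ z, Tendsto (fun t => ⟪u t, z⟫) l (𝓝 ⟪x, z⟫) := by
  let φ : α → WeakDual ℝ E := fun t =>
    StrongDual.toWeakDual (InnerProductSpace.toDual ℝ E (u t))
  have hmem : ∀ᶠ t in l, φ t ∈ WeakDual.toStrongDual ⁻¹'
      Metric.closedBall (0 : StrongDual ℝ E) R := by
    filter_upwards [hu] with t ht
    have h : ‖InnerProductSpace.toDual ℝ E (u t)‖ ≤ R := by simpa using ht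
    simpa [φ] using h
  obtain ⟨f, -, hf⟩ := (WeakDual.isCompact_closedBall (𝕜 := ℝ) (0 : StrongDual ℝ E) R
    ).ultrafilter_le_nhds (l.map φ) (le_principal_iff.2 hmem)
  refine ⟨(InnerProductSpace.toDual ℝ E).symm (WeakDual.toStrongDual f), fun z => ?_⟩
  have := tendsto_iff_forall_eval_tendsto_topDualPairing.1
    (show Tendsto φ l (𝓝 f) from hf) z
  rw [InnerProductSpace.toDual_symm_apply]
  simpa [φ] using! this

/-- **Opial's lemma** for functions that are bounded along a filter. -/
theorem exists_tendsto_inner_of_tendsto_norm_sub [CompleteSpace E] {α : Type*} {l : Filter α}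
    [l.NeBot] {u : α → E} {S : Set E} (hS : S.Nonempty)
    (hnorm : ∀ y ∈ S, ∃ L, Tendsto (fun t => ‖u t - y‖ ^ 2) l (𝓝 L))
    (hweak : ∀ g : Ultrafilter α, ↑g ≤ l → ∀ x,
      (∀ z, Tendsto (fun t => ⟪u t, z⟫) g (𝓝 ⟪x, z⟫)) → x ∈ S) :
    ∃ x ∈ S, ∀ z, Tendsto (fun t => ⟪u t, z⟫) l (𝓝 ⟪x, z⟫) := by
  obtain ⟨R, hR⟩ : ∃ R, ∀ᶠ t in l, ‖u t‖ ≤ R := by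
    obtain ⟨y, hy⟩ := hS
    obtain ⟨L, hL⟩ := hnorm y hy
    refine ⟨L + 2 + ‖y‖, ?_⟩
    filter_upwards [hL.eventually (gt_mem_nhds (lt_add_one L))] with t ht
    have h := norm_add_le (u t - y) y
    rw [sub_add_cancel] at h
    nlinarith [sq_nonneg (‖u t - y‖ - 1)]
  have hex : ∀ g : Ultrafilter α, ↑g ≤ l → ∃ x ∈ S,
      ∀ z, Tendsto (fun t => ⟪u t, z⟫) g (𝓝 ⟪x, z⟫) := fun g hg => by
    obtain ⟨x, hx⟩ := g.exists_tendsto_inner (hg hR)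
    exact ⟨x, hweak g hg x hx, hx⟩
  obtain ⟨x, hxS, hx⟩ := hex (Ultrafilter.of l) (Ultrafilter.of_le l)
  refine ⟨x, hxS, fun z => (tendsto_iff_ultrafilter _ _ _).2 fun g hg => ?_⟩
  obtain ⟨y, hyS, hy⟩ := hex g hg
  suffices x = y by
    rw [this]
    exact hy z
  obtain ⟨L, hL⟩ := hnorm x hxS
  obtain ⟨M, hM⟩ := hnorm y hyS
  have hinner : Tendsto (fun t => ⟪u t, x - y⟫) l
      (𝓝 ((M - L + (‖x‖ ^ 2 - ‖y‖ ^ 2)) / 2)) := by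
    refine (((hM.sub hL).add_const _).div_const 2).congr fun t => ?_
    rw [norm_sub_sq_real, norm_sub_sq_real, inner_sub_right]
    ring
  have h₁ := tendsto_nhds_unique (hx (x - y)) (hinner.mono_left (Ultrafilter.of_le l))
  have h₂ := tendsto_nhds_unique (hy (x - y)) (hinner.mono_left hg)
  rw [← sub_eq_zero, ← inner_self_eq_zero (𝕜 := ℝ), inner_sub_left, h₁, h₂, sub_self]

variable {I : E → EReal} {u : ℝ → E}

/-- Differences of time shifts of a gradient flow are nonincreasing in norm. -/
theorem norm_shift_sub_le_of_flow (hbot : ∀ x, I x ≠ ⊥) (hproper : ∃ x, I x ≠ ⊤)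
    (hlip : ∀ a b : ℝ, 0 < a → a ≤ b → ∃ K : NNReal, LipschitzOnWith K u (Icc a b))
    (hflow : ∀ᵐ t, 0 < t → DifferentiableAt ℝ u t ∧ -deriv u t ∈ subdiff I (u t))
    {a b h : ℝ} (ha : 0 < a) (hab : a ≤ b) (hh : 0 ≤ h) :
    ‖u (b + h) - u b‖ ≤ ‖u (a + h) - u a‖ := by
  obtain ⟨K, hK⟩ := hlip a (b + h) ha (by linarith)
  have hshift : LipschitzOnWith K (fun t => u (t + h)) (Icc a b) := by
    have := hK.comp ((LipschitzWith.id.add (LipschitzWith.const h)).lipschitzOnWith (s := Icc a b))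
      fun t ht => ⟨by simpa using by linarith [ht.1], by simpa using ht.2⟩
    simpa [Function.comp_def] using this
  have hsub : LipschitzOnWith (K + K) (fun t => u (t + h) - u t) (Icc a b) :=
    hshift.sub (hK.mono (Icc_subset_Icc_right (by linarith)))
  have hflow' : ∀ᵐ t, 0 < t + h →
      DifferentiableAt ℝ u (t + h) ∧ -deriv u (t + h) ∈ subdiff I (u (t + h)) :=
    (measurePreserving_add_right volume h).quasiMeasurePreserving.ae hflow
  have hsq := hsub.norm_sq_sub_norm_sq_le (c := 0) hab (by
    filter_upwards [hflow, hflow'] with t ht ht' hmem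
    have htpos : 0 < t := ha.trans hmem.1
    obtain ⟨hd, hv⟩ := ht htpos
    obtain ⟨hd', hv'⟩ := ht' (by linarith)
    refine ⟨_, (hd'.hasDerivAt.comp_add_const t h).sub hd.hasDerivAt, ?_⟩
    have := inner_sub_nonneg_of_mem_subdiff hbot hproper hv' hv
    rw [neg_sub_neg, ← neg_sub, inner_neg_left] at this
    linarith)
  exact (sq_le_sq₀ (norm_nonneg _) (norm_nonneg _)).1 (by linarith)

theorem norm_sq_sub_le_of_flow
    (hlip : ∀ a b : ℝ, 0 < a → a ≤ b → ∃ K : NNReal, LipschitzOnWith K u (Icc a b))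
    (hflow : ∀ᵐ t, 0 < t → DifferentiableAt ℝ u t ∧ -deriv u t ∈ subdiff I (u t))
    {a b m r : ℝ} {y : E} (hy : I y ≤ m) (ha : 0 < a) (hab : a ≤ b)
    (hr : ∀ t ∈ Icc a b, (r : EReal) ≤ I (u t)) :
    ‖u b - y‖ ^ 2 - ‖u a - y‖ ^ 2 ≤ 2 * (m - r) * (b - a) := by
  obtain ⟨K, hK⟩ := hlip a b ha hab
  have hsub : LipschitzOnWith (K + 0) (fun t => u t - y) (Icc a b) :=
    hK.sub (LipschitzWith.const y).lipschitzOnWith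
  refine hsub.norm_sq_sub_norm_sq_le hab ?_
  filter_upwards [hflow] with t ht hmem
  obtain ⟨hd, hv⟩ := ht (ha.trans hmem.1)
  refine ⟨_, hd.hasDerivAt.sub_const y, ?_⟩
  have := inner_le_of_mem_subdiff (hr t (Ioo_subset_Icc_self hmem)) hy hv
  rwa [← neg_sub (u t) y, inner_neg_neg] at this

/-- A gradient flow converges in norm to every sublevel set above the minimum. -/
theorem eventually_exists_sublevel_norm_sub_le_of_flow (hbot : ∀ x, I x ≠ ⊥)
    (hproper : ∃ x, I x ≠ ⊤)
    (hlip : ∀ a b : ℝ, 0 < a → a ≤ b → ∃ K : NNReal, LipschitzOnWith K u (Icc a b))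
    (hflow : ∀ᵐ t, 0 < t → DifferentiableAt ℝ u t ∧ -deriv u t ∈ subdiff I (u t))
    {m r L : ℝ} {y : E} (hy : I y ≤ m)
    (hL : Tendsto (fun t => ‖u t - y‖ ^ 2) atTop (𝓝 L)) (hmr : m < r) :
    ∀ δ > 0, ∀ᶠ t in atTop, ∃ p ∈ {x | I x ≤ r}, ‖u t - p‖ ≤ δ := by
  intro δ hδ
  obtain ⟨K, hK⟩ := hlip 1 2 one_pos one_le_two
  set η := min 1 (δ / (K + 1)) with hη
  have hη₀ : 0 < η := lt_min one_pos (by positivity)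
  have hη₁ : η ≤ 1 := min_le_left _ _
  have hKη : K * η ≤ δ := by
    have h := (le_div_iff₀ (by positivity : (0 : ℝ) < K + 1)).1 (min_le_right 1 (δ / (K + 1)))
    rw [← hη] at h
    linarith
  have hdiff : Tendsto (fun t => ‖u (t + η) - y‖ ^ 2 - ‖u t - y‖ ^ 2) atTop (𝓝 (L - L)) :=
    (hL.comp (tendsto_atTop_add_const_right _ η tendsto_id)).sub hL
  have hneg : 2 * (m - r) * η < L - L := by
    rw [sub_self]
    nlinarith
  filter_upwards [hdiff.eventually (lt_mem_nhds hneg), eventually_ge_atTop 1] with t ht ht₁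
  have hgood : ∃ s ∈ Icc t (t + η), I (u s) ≤ r := by
    by_contra! hbad
    have := norm_sq_sub_le_of_flow hlip hflow hy (by linarith) (by linarith)
      fun s hs => (hbad s hs).le
    rw [add_sub_cancel_left] at this
    linarith
  obtain ⟨s, hs, hsr⟩ := hgood
  refine ⟨u s, hsr, ?_⟩
  have hshift := norm_shift_sub_le_of_flow hbot hproper hlip hflow one_pos ht₁
    (sub_nonneg.2 hs.1)
  have hK' := hK.norm_sub_le (x := 1 + (s - t)) (y := 1)
    ⟨by linarith [hs.1], by linarith [hs.2]⟩ ⟨le_rfl, one_le_two⟩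
  rw [add_sub_cancel_left, Real.norm_of_nonneg (sub_nonneg.2 hs.1)] at hK'
  rw [add_sub_cancel] at hshift
  rw [norm_sub_rev]
  calc ‖u s - u t‖ ≤ K * (s - t) := hshift.trans hK'
    _ ≤ K * η := by
      gcongr
      linarith [hs.2]
    _ ≤ δ := hKη

end

/-- asymptotic weak convergence to a minimizer. Assume `I` attains
its minimum on `H`. If `u : [0,∞) → H` is continuous on `[0,∞)`, locally Lipschitz on
`(0,∞)`, and `−u'(t) ∈ ∂I(u(t))` a.e. on `(0,∞)`, then there exists a minimizer `u*`
of `I` such that `u(t) ⇀ u*` weakly in `H` as `t → ∞`. -/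
theorem gradient_flow_weak_convergence_to_minimizer
    (I : H → EReal) (hbot : ∀ x, I x ≠ ⊥) (hproper : ∃ x, I x ≠ ⊤)
    (hconv : ERealConvex I) (hlsc : LowerSemicontinuous I)
    (hmin : ∃ y : H, ∀ x : H, I y ≤ I x)
    (u : ℝ → H)
    (hcont : ContinuousOn u (Set.Ici 0))
    (hlip : ∀ a b : ℝ, 0 < a → a ≤ b →
      ∃ K : NNReal, LipschitzOnWith K u (Set.Icc a b))
    (hflow : ∀ᵐ t ∂(volume.restrict (Set.Ioi (0 : ℝ))),
      DifferentiableAt ℝ u t ∧ -deriv u t ∈ subdiff I (u t)) :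
    ∃ ustar : H, (∀ x : H, I ustar ≤ I x) ∧
      ∀ z : H, Tendsto (fun t : ℝ => ⟪u t, z⟫) atTop (𝓝 ⟪ustar, z⟫) := by
  have hflow' := (ae_restrict_iff' measurableSet_Ioi).1 hflow
  obtain ⟨y₀, hy₀⟩ := hmin
  have hfin : I y₀ ≠ ⊤ := by
    obtain ⟨x, hx⟩ := hproper
    exact ((hy₀ x).trans_lt hx.lt_top).ne
  set m := (I y₀).toReal
  have hm : (m : EReal) = I y₀ := EReal.coe_toReal hfin (hbot y₀)
  have hnorm : ∀ y, I y ≤ m → ∃ L, Tendsto (fun t => ‖u t - y‖ ^ 2) atTop (𝓝 L) := fun y hy => by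
    have hanti : Antitone fun t => ‖u (max t 1) - y‖ ^ 2 := fun a b hab => by
      have := norm_sq_sub_le_of_flow hlip hflow' hy (lt_max_of_lt_right one_pos)
        (max_le_max_right 1 hab) fun t _ => hm.trans_le (hy₀ (u t))
      rw [sub_self, mul_zero, zero_mul] at this
      exact sub_nonpos.1 this
    refine ⟨_, (tendsto_atTop_ciInf hanti ⟨0, ?_⟩).congr' ?_⟩
    · rintro _ ⟨t, rfl⟩
      positivity
    · filter_upwards [eventually_ge_atTop 1] with t ht
      rw [max_eq_left ht]
  obtain ⟨x, hx, hlim⟩ := exists_tendsto_inner_of_tendsto_norm_sub (S := {x | I x ≤ m})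
    ⟨y₀, hm.ge⟩ hnorm fun g hg x hx => by
      refine EReal.le_of_forall_lt_iff_le.1 fun r hr => ?_
      obtain ⟨L, hL⟩ := hnorm y₀ hm.ge
      refine (hconv.convex_sublevel r).mem_of_tendsto_weak (hlsc.isClosed_preimage r) (l := (g : Filter ℝ))
        (u := u) (fun f => ?_) fun δ hδ => hg (eventually_exists_sublevel_norm_sub_le_of_flow
          hbot hproper hlip hflow' hm.ge hL (EReal.coe_lt_coe_iff.1 hr) δ hδ)
      have hf : ∀ v, f v = ⟪v, (InnerProductSpace.toDual ℝ H).symm f⟫ := fun v => by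
        rw [real_inner_comm, InnerProductSpace.toDual_symm_apply]
      simpa only [hf] using hx _
  exact ⟨x, fun z => (hx.trans hm.le).trans (hy₀ z), hlim⟩
end

section
/- Integral monotonicity implies a.e. quasimonotonicity and quasiconvexity: let Ω ⊂ ℝⁿ be a nonempty bounded open set and let f : Ω × ℝ^{N×n} → ℝ be measurable in x with f(x,·) of class C¹ for a.e. x ∈ Ω, and assume the growth condition |D_ξ f(x,ξ)| ≤ c₂(x) + c₃(ξ) for a.e. x and all ξ, with 0 ≤ c₂ ∈ L¹(Ω) and c₃ : ℝ^{N×n} → [0,∞) continuous. Suppose that ∫_Ω [D_ξf(x, Dψ(x)+Dφ(x)) − D_ξf(x, Dψ(x))] : Dφ(x) dx ≥ 0 for all φ, ψ ∈ C_c^∞(Ω;ℝᴺ). Then for a.e. x₀ ∈ Ω the map D_ξf(x₀,·) is quasimonotone, i.e. for every nonempty bounded open set G ⊂ ℝⁿ, every ξ ∈ ℝ^{N×n} and every η ∈ C_c^∞(G;ℝᴺ), ∫_G D_ξf(x₀, ξ + Dη(y)) : Dη(y) dy ≥ 0; consequently, for a.e. x₀ ∈ Ω the function f(x₀,·) is quasiconvex,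 i.e. ∫_G f(x₀, ξ + Dη(y)) dy ≥ f(x₀, ξ)·|G| for all such G, ξ, η. -/
open MeasureTheory

/-- A test map: smooth and compactly supported inside `Ω`. -/
def TestMap {n N : ℕ} (Ω : Set (Fin n → ℝ)) (φ : (Fin n → ℝ) → Fin N → ℝ) : Prop :=
  ContDiff ℝ (⊤ : ℕ∞) φ ∧ HasCompactSupport φ ∧ tsupport φ ⊆ Ω

/-- The Jacobian matrix `Dφ(x) ∈ ℝ^{N×n}` of `φ : ℝⁿ → ℝᴺ` at `x`:
`(Dφ(x))_{ij} = ∂φⁱ/∂x_j`. Matrices are modeled as `Fin N → Fin n → ℝ`. -/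
noncomputable def jac {n N : ℕ} (φ : (Fin n → ℝ) → Fin N → ℝ) (x : Fin n → ℝ) :
    Fin N → Fin n → ℝ :=
  fun i j => fderiv ℝ φ x (Pi.single j 1) i

/-- The Frobenius inner product `ξ : η = ∑_{i,j} ξ_{ij} η_{ij}` on `ℝ^{N×n}`. -/
def mdot {n N : ℕ} (ξ η : Fin N → Fin n → ℝ) : ℝ := ∑ i, ∑ j, ξ i j * η i j

/-- The standard basis matrix `e_{ij}` of `ℝ^{N×n}`. -/
def eMat {n N : ℕ} (i : Fin N) (j : Fin n) : Fin N → Fin n → ℝ :=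
  Pi.single i (Pi.single j 1)

/-- The gradient matrix `D_ξ f(x, ξ) ∈ ℝ^{N×n}` of `f(x, ·)` at `ξ`. -/
noncomputable def gradx {n N : ℕ} (f : (Fin n → ℝ) → (Fin N → Fin n → ℝ) → ℝ)
    (x : Fin n → ℝ) (ξ : Fin N → Fin n → ℝ) : Fin N → Fin n → ℝ :=
  fun i j => fderiv ℝ (f x) ξ (eMat i j)

/-- The second partial derivative `∂²f(x,ξ)/∂ξ_{ij} ∂ξ_{kl}`. -/
noncomputable def hessc {n N : ℕ} (f : (Fin n → ℝ) → (Fin N → Fin n → ℝ) → ℝ)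
    (x : Fin n → ℝ) (ξ : Fin N → Fin n → ℝ)
    (i : Fin N) (j : Fin n) (k : Fin N) (l : Fin n) : ℝ :=
  fderiv ℝ (fun ζ => fderiv ℝ (f x) ζ (eMat k l)) ξ (eMat i j)

/-- The Hessian quadratic form
`D²_ξ f(x,ξ)(η,η) = ∑_{i,j,k,l} (∂²f/∂ξ_{ij}∂ξ_{kl}) η_{ij} η_{kl}`. -/
noncomputable def hessQ {n N : ℕ} (f : (Fin n → ℝ) → (Fin N → Fin n → ℝ) → ℝ)
    (x : Fin n → ℝ) (ξ η : Fin N → Fin n → ℝ) : ℝ :=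
  ∑ i, ∑ j, ∑ k, ∑ l, hessc f x ξ i j k l * η i j * η k l

open Filter Topology Metric

/-- A family of continuous maps on a compact metrizable space is strongly measurable as soon as all
its evaluations are measurable. -/
lemma stronglyMeasurable_continuousMap_of_eval {X K E : Type*} [MeasurableSpace X]
    [PseudoMetricSpace K] [CompactSpace K] [NormedAddCommGroup E] [SecondCountableTopology E]
    [MeasurableSpace E] [BorelSpace E] (F : X → C(K, E))
    (hF : ∀ k, Measurable fun x => F x k) : StronglyMeasurable F := by
  borelize C(K, E)
  have hdist : ∀ g : C(K, E), Measurable fun x => dist (F x) g := by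
    intro g
    refine measurable_of_Iic fun r => ?_
    rcases lt_or_ge r 0 with hr | hr
    · have : (fun x => dist (F x) g) ⁻¹' Set.Iic r = ∅ := by
        ext x
        simpa using hr.trans_le dist_nonneg
      rw [this]
      exact MeasurableSet.empty
    · obtain ⟨s, hsc, hsd⟩ := TopologicalSpace.exists_countable_dense K
      have : (fun x => dist (F x) g) ⁻¹' Set.Iic r = ⋂ k ∈ s, {x | dist (F x k) (g k) ≤ r} := by
        ext x
        simp only [Set.mem_preimage, Set.mem_Iic, Set.mem_iInter, Set.mem_ofPred_eq,
          ContinuousMap.dist_le hr]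
        refine ⟨fun h k _ => h k, fun h k => ?_⟩
        have hcl : IsClosed {k | dist (F x k) (g k) ≤ r} :=
          isClosed_le (by fun_prop) continuous_const
        exact hcl.closure_subset_iff.2 h (hsd k)
      rw [this]
      exact MeasurableSet.biInter hsc fun k _ =>
        measurableSet_le ((hF k).dist measurable_const) measurable_const
  refine Measurable.stronglyMeasurable ?_
  have hb : borel C(K, E) = MeasurableSpace.generateFrom
      {s | ∃ g r, s = ball (g : C(K, E)) r} := by
    refine TopologicalSpace.IsTopologicalBasis.borel_eq_generateFrom ?_
    refine TopologicalSpace.isTopologicalBasis_of_isOpen_of_nhds ?_ ?_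
    · rintro _ ⟨g, r, rfl⟩
      exact isOpen_ball
    · intro g u hg hu
      obtain ⟨r, hr, h⟩ := Metric.isOpen_iff.1 hu g hg
      exact ⟨_, ⟨g, r, rfl⟩, mem_ball_self hr, h⟩
  rw [BorelSpace.measurable_eq (α := C(K, E)), hb]
  refine measurable_generateFrom ?_
  rintro _ ⟨g, r, rfl⟩
  exact measurableSet_lt (hdist g) measurable_const

/-- Lebesgue points of a Carathéodory map with locally integrable growth, uniformly with respect to
the second variable in a ball. -/
lemma ae_exists_modulus_tendsto_average {n : ℕ} {E E' : Type*}
    [NormedAddCommGroup E] [ProperSpace E] [NormedAddCommGroup E']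
    [SecondCountableTopology E'] [MeasurableSpace E'] [BorelSpace E']
    (F : (Fin n → ℝ) → E → E') (hcont : ∀ x, Continuous (F x))
    (hmeas : ∀ ξ, Measurable fun x => F x ξ) (g : (Fin n → ℝ) → ℝ) (hg : Integrable g)
    (c : E → ℝ) (hc : Continuous c) (hbound : ∀ x ξ, ‖F x ξ‖ ≤ g x + c ξ) :
    ∀ᵐ x₀, ∀ R : ℕ, ∃ D : (Fin n → ℝ) → ℝ, LocallyIntegrable D ∧
      (∀ x ξ, ‖ξ‖ ≤ R → ‖F x ξ - F x₀ ξ‖ ≤ D x) ∧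
      Tendsto (fun r => ⨍ x in closedBall x₀ r, D x) (𝓝[>] (0 : ℝ)) (𝓝 0) := by
  rw [ae_all_iff]
  intro R
  let K := closedBall (0 : E) R
  have : CompactSpace K := isCompact_iff_compactSpace.1 (isCompact_closedBall _ _)
  let Φ : (Fin n → ℝ) → C(K, E') := fun x => ⟨fun k => F x k, (hcont x).comp continuous_subtype_val⟩
  have hΦ : StronglyMeasurable Φ := stronglyMeasurable_continuousMap_of_eval Φ fun k => hmeas k
  obtain ⟨M, hM⟩ := (isCompact_closedBall (0 : E) R).exists_bound_of_continuousOn hc.continuousOn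
  have hM0 : 0 ≤ M := (norm_nonneg _).trans (hM 0 (by simp))
  have hli : LocallyIntegrable Φ := by
    have h1 : LocallyIntegrable (fun x => |g x| + M) :=
      hg.abs.locallyIntegrable.add (locallyIntegrable_const M)
    refine h1.mono hΦ.aestronglyMeasurable (Eventually.of_forall fun x => ?_)
    rw [Real.norm_eq_abs]
    refine le_trans ?_ (le_abs_self _)
    refine (ContinuousMap.norm_le _ (by positivity)).2 fun k => (hbound x k).trans ?_
    exact add_le_add (le_abs_self _) ((le_abs_self _).trans (hM k k.2))
  filter_upwards [IsUnifLocDoublingMeasure.ae_tendsto_average_norm_sub volume hli 1] with x₀ hx₀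
  refine ⟨fun x => ‖Φ x - Φ x₀‖, ?_, ?_, ?_⟩
  · exact fun x => ((hli.sub (locallyIntegrable_const (Φ x₀))) x).norm
  · intro x ξ hξ
    exact (Φ x - Φ x₀).norm_coe_le_norm ⟨ξ, by simpa [K] using hξ⟩
  · refine hx₀ (fun _ => x₀) (fun r => r) tendsto_id ?_
    filter_upwards [self_mem_nhdsWithin] with r hr
    simpa using le_of_lt hr

section Jacobian

variable {n N : ℕ}

lemma TestMap.jac_continuous {G : Set (Fin n → ℝ)} {φ : (Fin n → ℝ) → Fin N → ℝ}
    (hφ : TestMap G φ) : Continuous (jac φ) := by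
  have h : Continuous (fderiv ℝ φ) := hφ.1.continuous_fderiv (by simp)
  unfold jac
  fun_prop

lemma jac_eq_zero_of_notMem_tsupport {φ : (Fin n → ℝ) → Fin N → ℝ} {x : Fin n → ℝ}
    (hx : x ∉ tsupport φ) : jac φ x = 0 := by
  ext i j
  simp [jac, fderiv_of_notMem_tsupport ℝ hx]

lemma TestMap.jac_eq_zero {G : Set (Fin n → ℝ)} {φ : (Fin n → ℝ) → Fin N → ℝ}
    (hφ : TestMap G φ) {x : Fin n → ℝ} (hx : x ∉ G) : jac φ x = 0 :=
  jac_eq_zero_of_notMem_tsupport fun h => hx (hφ.2.2 h)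

lemma TestMap.hasCompactSupport_jac {G : Set (Fin n → ℝ)} {φ : (Fin n → ℝ) → Fin N → ℝ}
    (hφ : TestMap G φ) : HasCompactSupport (jac φ) :=
  HasCompactSupport.intro hφ.2.1 fun _ hx => jac_eq_zero_of_notMem_tsupport hx

lemma TestMap.const_smul {G : Set (Fin n → ℝ)} {φ : (Fin n → ℝ) → Fin N → ℝ}
    (hφ : TestMap G φ) (t : ℝ) : TestMap G (t • φ) :=
  ⟨hφ.1.const_smul t, hφ.2.1.smul_left (f := fun _ => t),
    (tsupport_smul_subset_right (fun _ => t) φ).trans hφ.2.2⟩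

lemma TestMap.jac_const_smul {G : Set (Fin n → ℝ)} {φ : (Fin n → ℝ) → Fin N → ℝ}
    (hφ : TestMap G φ) (t : ℝ) (x : Fin n → ℝ) : jac (t • φ) x = t • jac φ x := by
  have hd : DifferentiableAt ℝ φ x := (hφ.1.differentiable (by simp)) x
  ext i j
  simp [jac, fderiv_const_smul hd]

lemma TestMap.integral_jac_eq_zero {G : Set (Fin n → ℝ)} {φ : (Fin n → ℝ) → Fin N → ℝ}
    (hφ : TestMap G φ) : ∫ x, jac φ x = 0 := by
  have hint : Integrable (jac φ) := hφ.jac_continuous.integrable_of_hasCompactSupport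
    hφ.hasCompactSupport_jac
  ext i j
  have hd : Differentiable ℝ φ := hφ.1.differentiable (by simp)
  have hv : Integrable fun x => fderiv ℝ φ x (Pi.single j 1) :=
    (((hφ.1.continuous_fderiv (by simp)).clm_apply continuous_const)).integrable_of_hasCompactSupport
      (hφ.2.1.fderiv_apply ℝ _)
  have key := integral_smul_fderiv_eq_neg_fderiv_smul_of_integrable (𝕜 := ℝ)
    (μ := (volume : Measure (Fin n → ℝ))) (f := fun _ => (1 : ℝ)) (g := φ)
    (v := Pi.single j 1) (by simp) (by simpa using hv)
    (by simpa using hφ.1.continuous.integrable_of_hasCompactSupport hφ.2.1)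
    (by simp) (fun x _ => hd x)
  simp only [one_smul, fderiv_fun_const, Pi.zero_apply, _root_.zero_apply, zero_smul,
    integral_zero, neg_zero] at key
  have h1 : (∫ x, jac φ x) i j = ∫ x, jac φ x i j := by
    rw [eval_integral fun i => hint.eval i, eval_integral fun j => (hint.eval i).eval j]
  have h2 : (∫ x, fderiv ℝ φ x (Pi.single j 1)) i = ∫ x, fderiv ℝ φ x (Pi.single j 1) i :=
    eval_integral (fun i => hv.eval i) i
  rw [h1]
  change ∫ x, fderiv ℝ φ x (Pi.single j 1) i = 0
  rw [← h2, key]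
  rfl

/-- The map `x ↦ ε η((x - x₀)/ε)`. -/
noncomputable def rescale (η : (Fin n → ℝ) → Fin N → ℝ) (x₀ : Fin n → ℝ) (ε : ℝ)
    (x : Fin n → ℝ) : Fin N → ℝ :=
  ε • η (ε⁻¹ • (x - x₀))

lemma jac_rescale {η : (Fin n → ℝ) → Fin N → ℝ} (hη : Differentiable ℝ η) (x₀ : Fin n → ℝ)
    {ε : ℝ} (hε : ε ≠ 0) (x : Fin n → ℝ) :
    jac (rescale η x₀ ε) x = jac η (ε⁻¹ • (x - x₀)) := by
  have h1 : HasFDerivAt (fun x : Fin n → ℝ => ε⁻¹ • (x - x₀))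
      (ε⁻¹ • ContinuousLinearMap.id ℝ (Fin n → ℝ)) x :=
    ((hasFDerivAt_id x).sub_const x₀).const_smul ε⁻¹
  have h2 := ((hη (ε⁻¹ • (x - x₀))).hasFDerivAt.comp x h1).const_smul ε
  have h3 : fderiv ℝ (rescale η x₀ ε) x = _ := h2.fderiv
  ext i j
  simp [jac, h3, hε]

lemma TestMap.rescale {G Ω : Set (Fin n → ℝ)} {η : (Fin n → ℝ) → Fin N → ℝ} (hη : TestMap G η)
    {x₀ : Fin n → ℝ} {ε ρ : ℝ} (hε : 0 < ε) (hρ : tsupport η ⊆ closedBall 0 ρ)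
    (hΩ : closedBall x₀ (ε * ρ) ⊆ Ω) : TestMap Ω (rescale η x₀ ε) := by
  have h0 : ∀ x ∉ closedBall x₀ (ε * ρ), _root_.rescale η x₀ ε x = 0 := by
    intro x hx
    have : ε⁻¹ • (x - x₀) ∉ closedBall (0 : Fin n → ℝ) ρ := by
      simp only [mem_closedBall, dist_eq_norm, sub_zero, norm_smul, norm_inv, Real.norm_eq_abs,
        abs_of_pos hε, not_le] at hx ⊢
      rwa [lt_inv_mul_iff₀ hε]
    simp [_root_.rescale, image_eq_zero_of_notMem_tsupport fun h => this (hρ h)]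
  refine ⟨?_, HasCompactSupport.intro (isCompact_closedBall _ _) fun x hx => h0 x hx, ?_⟩
  · have := hη.1
    unfold _root_.rescale
    fun_prop
  · refine (closure_minimal (fun x hx => ?_) isClosed_closedBall).trans hΩ
    by_contra h
    exact hx (h0 x h)

/-- A test map whose Jacobian is a prescribed constant near a point. -/
lemma exists_testMap_jac_eq {Ω : Set (Fin n → ℝ)} {x₀ : Fin n → ℝ} {δ : ℝ} (hδ : 0 < δ)
    (hΩ : closedBall x₀ (2 * δ) ⊆ Ω) (ξ : Fin N → Fin n → ℝ) :
    ∃ ψ : (Fin n → ℝ) → Fin N → ℝ, TestMap Ω ψ ∧ ∀ x ∈ ball x₀ δ, jac ψ x = ξ := by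
  let χ : ContDiffBump x₀ := ⟨δ, 2 * δ, hδ, by linarith⟩
  let L : (Fin n → ℝ) →L[ℝ] (Fin N → ℝ) := (Matrix.of ξ).mulVecLin.toContinuousLinearMap
  refine ⟨fun x => χ x • L x, ⟨χ.contDiff.smul L.contDiff, χ.hasCompactSupport.smul_right, ?_⟩, ?_⟩
  · exact (tsupport_smul_subset_left χ L).trans (χ.tsupport_eq.trans_subset hΩ)
  · intro x hx
    have : (fun x => χ x • L x) =ᶠ[𝓝 x] L := by
      filter_upwards [isOpen_ball.mem_nhds hx] with y hy
      rw [χ.one_of_mem_closedBall (ball_subset_closedBall hy), one_smul]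
    ext i j
    rw [jac, this.fderiv_eq, L.fderiv]
    simp [L]

end Jacobian

section MatrixProduct

variable {n N : ℕ}

lemma continuous_mdot : Continuous fun p : (Fin N → Fin n → ℝ) × (Fin N → Fin n → ℝ) =>
    mdot p.1 p.2 := by
  unfold mdot
  fun_prop

@[fun_prop]
lemma Continuous.mdot {X : Type*} [TopologicalSpace X] {u v : X → Fin N → Fin n → ℝ}
    (hu : Continuous u) (hv : Continuous v) : Continuous fun x => mdot (u x) (v x) :=
  continuous_mdot.comp (hu.prodMk hv)

lemma Measurable.mdot {X : Type*} [MeasurableSpace X] {u v : X → Fin N → Fin n → ℝ}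
    (hu : Measurable u) (hv : Measurable v) : Measurable fun x => mdot (u x) (v x) :=
  continuous_mdot.measurable.comp (hu.prodMk hv)

lemma mdot_sub_left (a b c : Fin N → Fin n → ℝ) : mdot (a - b) c = mdot a c - mdot b c := by
  simp [mdot, sub_mul]

lemma mdot_zero_right (a : Fin N → Fin n → ℝ) : mdot a 0 = 0 := by simp [mdot]

lemma mdot_smul_right (a b : Fin N → Fin n → ℝ) (t : ℝ) : mdot a (t • b) = t * mdot a b := by
  simp only [mdot, Finset.mul_sum, Pi.smul_apply, smul_eq_mul]
  exact Finset.sum_congr rfl fun i _ => Finset.sum_congr rfl fun j _ => by ring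

lemma abs_mdot_le (a b : Fin N → Fin n → ℝ) : |mdot a b| ≤ N * n * (‖a‖ * ‖b‖) := by
  have h : ∀ (c : Fin N → Fin n → ℝ) i j, |c i j| ≤ ‖c‖ := fun c i j =>
    (norm_le_pi_norm (c i) j).trans (norm_le_pi_norm c i)
  calc |mdot a b| ≤ ∑ i, ∑ j, |a i j * b i j| :=
        (Finset.abs_sum_le_sum_abs _ _).trans
          (Finset.sum_le_sum fun i _ => Finset.abs_sum_le_sum_abs _ _)
    _ ≤ ∑ _i : Fin N, ∑ _j : Fin n, ‖a‖ * ‖b‖ := by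
        gcongr with i _ j _
        rw [abs_mul]
        exact mul_le_mul (h a i j) (h b i j) (abs_nonneg _) (norm_nonneg _)
    _ = N * n * (‖a‖ * ‖b‖) := by simp; ring

lemma norm_le_sqrt_mdot_self (a : Fin N → Fin n → ℝ) : ‖a‖ ≤ √(mdot a a) := by
  refine (pi_norm_le_iff_of_nonneg (Real.sqrt_nonneg _)).2 fun i =>
    (pi_norm_le_iff_of_nonneg (Real.sqrt_nonneg _)).2 fun j => Real.abs_le_sqrt ?_
  have h1 : a i j * a i j ≤ ∑ j, a i j * a i j :=
    Finset.single_le_sum (f := fun j => a i j * a i j) (fun j _ => mul_self_nonneg _)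
      (Finset.mem_univ j)
  have h2 : ∑ j, a i j * a i j ≤ mdot a a :=
    Finset.single_le_sum (f := fun i => ∑ j, a i j * a i j)
      (fun i _ => Finset.sum_nonneg fun j _ => mul_self_nonneg _) (Finset.mem_univ i)
  rw [pow_two]
  exact h1.trans h2

lemma fderiv_apply_eq_mdot_gradx (f : (Fin n → ℝ) → (Fin N → Fin n → ℝ) → ℝ) (x : Fin n → ℝ)
    (ξ M : Fin N → Fin n → ℝ) : fderiv ℝ (f x) ξ M = mdot (gradx f x ξ) M := by
  have hM : M = ∑ i, ∑ j, M i j • (eMat i j : Fin N → Fin n → ℝ) := by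
    ext k l
    simp [Finset.sum_apply, eMat, Pi.single_apply, apply_ite, ite_apply]
  conv_lhs => rw [hM]
  simp only [map_sum, map_smul, smul_eq_mul, mdot, gradx, mul_comm]

lemma integral_mdot_const {G : Set (Fin n → ℝ)} {φ : (Fin n → ℝ) → Fin N → ℝ}
    (hφ : TestMap G φ) (a : Fin N → Fin n → ℝ) : ∫ x, mdot a (jac φ x) = 0 := by
  have hint : Integrable (jac φ) := hφ.jac_continuous.integrable_of_hasCompactSupport
    hφ.hasCompactSupport_jac
  have h0 := hφ.integral_jac_eq_zero
  simp only [mdot]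
  rw [integral_finsetSum _ fun i _ => integrable_finsetSum _ fun j _ =>
    ((hint.eval i).eval j).const_mul _]
  refine Finset.sum_eq_zero fun i _ => ?_
  rw [integral_finsetSum _ fun j _ => ((hint.eval i).eval j).const_mul _]
  refine Finset.sum_eq_zero fun j _ => ?_
  rw [integral_const_mul, ← eval_integral fun j => (hint.eval i).eval j,
    ← eval_integral fun i => hint.eval i, h0]
  simp

end MatrixProduct

section Quasimonotone

variable {n N : ℕ}

/-- Blow-up: an integrally monotone Carathéodory map is quasimonotone at each Lebesgue point. -/
lemma quasimonotone_of_modulus_tendsto_average {Ω : Set (Fin n → ℝ)} (hΩ : IsOpen Ω)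
    (F : (Fin n → ℝ) → (Fin N → Fin n → ℝ) → Fin N → Fin n → ℝ) (hcont : ∀ x, Continuous (F x))
    (hmeas : ∀ ξ, Measurable fun x => F x ξ)
    (hmono : ∀ φ ψ : (Fin n → ℝ) → Fin N → ℝ, TestMap Ω φ → TestMap Ω ψ →
      0 ≤ ∫ x in Ω, mdot (F x (jac ψ x + jac φ x) - F x (jac ψ x)) (jac φ x))
    {x₀ : Fin n → ℝ} (hx₀ : x₀ ∈ Ω)
    (hD : ∀ R : ℕ, ∃ D : (Fin n → ℝ) → ℝ, LocallyIntegrable D ∧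
      (∀ x ξ, ‖ξ‖ ≤ R → ‖F x ξ - F x₀ ξ‖ ≤ D x) ∧
      Tendsto (fun r => ⨍ x in closedBall x₀ r, D x) (𝓝[>] (0 : ℝ)) (𝓝 0))
    {G : Set (Fin n → ℝ)} {η : (Fin n → ℝ) → Fin N → ℝ} (hη : TestMap G η)
    (ξ : Fin N → Fin n → ℝ) :
    0 ≤ ∫ y, mdot (F x₀ (ξ + jac η y)) (jac η y) := by
  obtain ⟨δ, hδ, hδΩ⟩ : ∃ δ > 0, closedBall x₀ (2 * δ) ⊆ Ω := by
    obtain ⟨s, hs, h⟩ := Metric.nhds_basis_closedBall.mem_iff.1 (hΩ.mem_nhds hx₀)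
    exact ⟨s / 2, half_pos hs, by rwa [mul_div_cancel₀ s two_ne_zero]⟩
  obtain ⟨ρ, hρ, hρη⟩ : ∃ ρ > 0, tsupport η ⊆ closedBall 0 ρ := by
    obtain ⟨s, hs⟩ := hη.2.1.isBounded.subset_closedBall (0 : Fin n → ℝ)
    exact ⟨max s 1, by positivity, hs.trans (closedBall_subset_closedBall (le_max_left _ _))⟩
  obtain ⟨M, hM⟩ := hη.hasCompactSupport_jac.exists_bound_of_continuous hη.jac_continuous
  have hM0 : 0 ≤ M := (norm_nonneg _).trans (hM 0)
  obtain ⟨R, hR⟩ := exists_nat_ge (‖ξ‖ + M)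
  obtain ⟨D, hDint, hDF, hDlim⟩ := hD R
  have hJ := hη.jac_continuous
  have hF₀ := hcont x₀
  have hJ0 : ∀ y ∉ closedBall (0 : Fin n → ℝ) ρ, jac η y = 0 := fun y hy =>
    jac_eq_zero_of_notMem_tsupport fun h => hy (hρη h)
  let b : (Fin n → ℝ) → ℝ := fun y => mdot (F x₀ (ξ + jac η y) - F x₀ ξ) (jac η y)
  have hbcont : Continuous b := by fun_prop
  have hbint : Integrable b := hbcont.integrable_of_hasCompactSupport <|
    HasCompactSupport.intro (isCompact_closedBall 0 ρ) fun y hy => by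
      simp [b, hJ0 y hy, mdot_zero_right]
  let V : ℝ := volume.real (ball (0 : Fin n → ℝ) 1)
  let C : ℝ := 2 * (N * n * M)
  have key : ∀ᶠ r in 𝓝[>] (0 : ℝ),
      -(C * ρ ^ n * V * ⨍ x in closedBall x₀ r, D x) ≤ ∫ y, b y := by
    filter_upwards [Ioo_mem_nhdsGT hδ] with r hr
    let ε := r / ρ
    have hε : 0 < ε := div_pos hr.1 hρ
    have hερ : ε * ρ = r := div_mul_cancel₀ r hρ.ne'
    have hrΩ : closedBall x₀ r ⊆ Ω :=
      (closedBall_subset_closedBall (by linarith [hr.2])).trans hδΩ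
    obtain ⟨ψ, hψ, hψξ⟩ := exists_testMap_jac_eq hδ hδΩ ξ
    have hφ : TestMap Ω (rescale η x₀ ε) := hη.rescale hε hρη (by rwa [hερ])
    let u : (Fin n → ℝ) → Fin N → Fin n → ℝ := fun x => jac η (ε⁻¹ • (x - x₀))
    have hφu : jac (rescale η x₀ ε) = u :=
      funext fun x => jac_rescale (hη.1.differentiable (by simp)) x₀ hε.ne' x
    have hu : Continuous u := by fun_prop
    have hu0 : ∀ x ∉ closedBall x₀ r, u x = 0 := by
      intro x hx
      refine hJ0 _ ?_
      simp only [mem_closedBall, dist_eq_norm, sub_zero, norm_smul, norm_inv, Real.norm_eq_abs,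
        abs_of_pos hε, not_le] at hx ⊢
      rwa [lt_inv_mul_iff₀ hε, hερ]
    let A : (Fin n → ℝ) → ℝ := fun x => mdot (F x (ξ + u x) - F x ξ) (u x)
    let B : (Fin n → ℝ) → ℝ := fun x => b (ε⁻¹ • (x - x₀))
    have hA : 0 ≤ ∫ x, A x := by
      refine (hmono _ ψ hφ hψ).trans_eq ?_
      rw [hφu, setIntegral_eq_integral_of_forall_compl_eq_zero]
      · refine integral_congr_ae (Eventually.of_forall fun x => ?_)
        by_cases hx : x ∈ closedBall x₀ r
        · simp only [A, hψξ x (closedBall_subset_ball hr.2 hx)]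
        · simp [A, hu0 x hx, mdot_zero_right]
      · intro x hx
        rw [hu0 x fun h => hx (hrΩ h), mdot_zero_right]
    have hBint : Integrable B := (hbint.comp_smul (inv_ne_zero hε.ne')).comp_sub_right x₀
    have hB : ∫ x, B x = ε ^ n * ∫ y, b y := by
      rw [integral_sub_right_eq_self (fun x => b (ε⁻¹ • x)) x₀,
        Measure.integral_comp_inv_smul_of_nonneg _ _ hε.le]
      simp
    have hFm : Measurable (Function.uncurry fun ζ x => F x ζ) :=
      measurable_uncurry_of_continuous_of_measurable hcont hmeas
    have hAm : Measurable A :=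
      ((hFm.comp ((hu.measurable.const_add ξ).prodMk measurable_id)).sub (hmeas ξ)).mdot
        hu.measurable
    have hle : ∀ x, |A x - B x| ≤ (closedBall x₀ r).indicator (fun x => C * D x) x := by
      intro x
      by_cases hx : x ∈ closedBall x₀ r
      · rw [Set.indicator_of_mem hx]
        have hux : ‖u x‖ ≤ M := hM _
        have hD0 : 0 ≤ D x := (norm_nonneg _).trans (hDF x 0 (by simp))
        have e : A x - B x = mdot (F x (ξ + u x) - F x₀ (ξ + u x)) (u x)
            - mdot (F x ξ - F x₀ ξ) (u x) := by
          simp only [A, B, b, u, mdot_sub_left]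
          ring
        have h : ∀ ζ, ‖ζ‖ ≤ R → |mdot (F x ζ - F x₀ ζ) (u x)| ≤ N * n * (D x * M) :=
          fun ζ hζ => (abs_mdot_le _ _).trans (by gcongr; exact hDF x ζ hζ)
        have h1 := h (ξ + u x) ((norm_add_le _ _).trans (by linarith))
        have h2 := h ξ (by linarith)
        rw [e]
        refine (abs_sub _ _).trans ?_
        simp only [C]
        linarith
      · simp [hx, A, B, b, u, show jac η (ε⁻¹ • (x - x₀)) = 0 from hu0 x hx, mdot_zero_right]
    have hDon : IntegrableOn D (closedBall x₀ r) :=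
      hDint.integrableOn_isCompact (isCompact_closedBall _ _)
    have hdom : Integrable ((closedBall x₀ r).indicator fun x => C * D x) :=
      (integrable_indicator_iff measurableSet_closedBall).2 (hDon.const_mul C)
    have hABint : Integrable fun x => A x - B x :=
      hdom.mono' (hAm.aestronglyMeasurable.sub hBint.aestronglyMeasurable)
        (Eventually.of_forall hle)
    have hAB : ∫ x, (A x - B x) ≤ C * (r ^ n * V * ⨍ x in closedBall x₀ r, D x) := by
      calc ∫ x, (A x - B x) ≤ ∫ x, (closedBall x₀ r).indicator (fun x => C * D x) x :=
            integral_mono hABint hdom fun x => (le_abs_self _).trans (hle x)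
        _ = C * (r ^ n * V * ⨍ x in closedBall x₀ r, D x) := by
            rw [integral_indicator measurableSet_closedBall, integral_const_mul,
              ← measure_smul_setAverage D measure_closedBall_lt_top.ne, smul_eq_mul,
              measureReal_def, Measure.addHaar_closedBall _ _ hr.1.le, ENNReal.toReal_mul,
              ENNReal.toReal_ofReal (by have := hr.1; positivity)]
            simp [V, measureReal_def]
    have hsum : ∫ x, A x = (∫ x, B x) + ∫ x, (A x - B x) := by
      rw [← integral_add hBint hABint]
      simp
    have : 0 ≤ ε ^ n * ((∫ y, b y) + C * ρ ^ n * V * ⨍ x in closedBall x₀ r, D x) := by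
      have hrn : r ^ n = ε ^ n * ρ ^ n := by rw [← mul_pow, hερ]
      rw [hrn] at hAB
      linarith
    linarith [nonneg_of_mul_nonneg_right this (pow_pos hε n)]
  have hlim : Tendsto (fun r => -(C * ρ ^ n * V * ⨍ x in closedBall x₀ r, D x)) (𝓝[>] (0 : ℝ))
      (𝓝 0) := by
    simpa using (hDlim.const_mul (C * ρ ^ n * V)).neg
  refine (le_of_tendsto hlim key).trans_eq ?_
  have hc : Integrable fun y => mdot (F x₀ ξ) (jac η y) :=
    (by fun_prop : Continuous fun y => mdot (F x₀ ξ) (jac η y)).integrable_of_hasCompactSupport <|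
      HasCompactSupport.intro (isCompact_closedBall 0 ρ) fun y hy => by
        simp [hJ0 y hy, mdot_zero_right]
  have h := integral_add hbint hc
  rw [integral_mdot_const hη, add_zero] at h
  rw [← h]
  simp [b, mdot_sub_left]

end Quasimonotone

section Quasiconvex

variable {n N : ℕ}

/-- A `C¹` integrand with quasimonotone gradient is quasiconvex. -/
lemma quasiconvex_of_quasimonotone (f : (Fin n → ℝ) → (Fin N → Fin n → ℝ) → ℝ) (x₀ : Fin n → ℝ)
    (hf : ContDiff ℝ 1 (f x₀)) {G : Set (Fin n → ℝ)} (hGb : Bornology.IsBounded G)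
    (ξ : Fin N → Fin n → ℝ)
    (hq : ∀ η : (Fin n → ℝ) → Fin N → ℝ, TestMap G η →
      0 ≤ ∫ y in G, mdot (gradx f x₀ (ξ + jac η y)) (jac η y))
    {η : (Fin n → ℝ) → Fin N → ℝ} (hη : TestMap G η) :
    f x₀ ξ * (volume G).toReal ≤ ∫ y in G, f x₀ (ξ + jac η y) := by
  have : IsFiniteMeasure (volume.restrict G) := ⟨by simpa using hGb.measure_lt_top⟩
  have hJ := hη.jac_continuous
  have hfc := hf.continuous
  have hf' : Continuous (fderiv ℝ (f x₀)) := hf.continuous_fderiv (by simp)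
  have hfd : Differentiable ℝ (f x₀) := hf.differentiable (by simp)
  obtain ⟨M, hM⟩ := hη.hasCompactSupport_jac.exists_bound_of_continuous hJ
  have hM0 : 0 ≤ M := (norm_nonneg _).trans (hM 0)
  have hderiv : ∀ t : ℝ, HasDerivAt (fun t : ℝ => ∫ y in G, f x₀ (ξ + t • jac η y))
      (∫ y in G, fderiv ℝ (f x₀) (ξ + t • jac η y) (jac η y)) t := by
    intro t
    obtain ⟨C, hC⟩ := (isCompact_closedBall (0 : Fin N → Fin n → ℝ)
      (‖ξ‖ + (|t| + 1) * M)).exists_bound_of_continuousOn hf'.continuousOn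
    refine (hasDerivAt_integral_of_dominated_loc_of_deriv_le (bound := fun _ => C * M)
      (F' := fun t y => fderiv ℝ (f x₀) (ξ + t • jac η y) (jac η y))
      (ball_mem_nhds t one_pos) ?_ ?_ ?_ ?_ (integrable_const _) ?_).2
    · exact Eventually.of_forall fun s => (by fun_prop :
        Continuous fun y => f x₀ (ξ + s • jac η y)).aestronglyMeasurable
    · exact ((by fun_prop : Continuous fun y => f x₀ (ξ + t • jac η y)).continuousOn
        |>.integrableOn_compact hGb.isCompact_closure).mono_set subset_closure
    · exact (by fun_prop : Continuous fun y =>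
        fderiv ℝ (f x₀) (ξ + t • jac η y) (jac η y)).aestronglyMeasurable
    · refine Eventually.of_forall fun y s hs => ?_
      have hs' : |s| ≤ |t| + 1 := by
        rw [mem_ball, Real.dist_eq] at hs
        linarith [abs_sub_abs_le_abs_sub s t]
      have hmem : ξ + s • jac η y ∈ closedBall (0 : Fin N → Fin n → ℝ)
          (‖ξ‖ + (|t| + 1) * M) := by
        rw [mem_closedBall_zero_iff]
        refine (norm_add_le _ _).trans (add_le_add le_rfl ?_)
        rw [norm_smul, Real.norm_eq_abs]
        exact mul_le_mul hs' (hM y) (norm_nonneg _) (by positivity)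
      have hC' := hC _ hmem
      exact (ContinuousLinearMap.le_opNorm _ _).trans
        (mul_le_mul hC' (hM y) (norm_nonneg _) ((norm_nonneg _).trans hC'))
    · refine Eventually.of_forall fun y s _ => ?_
      have h1 : HasDerivAt (fun s : ℝ => ξ + s • jac η y) (jac η y) s := by
        simpa using ((hasDerivAt_id s).smul_const (jac η y)).const_add ξ
      exact (hfd _).hasFDerivAt.comp_hasDerivAt s h1
  have hmono : MonotoneOn (fun t : ℝ => ∫ y in G, f x₀ (ξ + t • jac η y)) (Set.Icc 0 1) := by
    refine monotoneOn_of_deriv_nonneg (convex_Icc 0 1)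
      (fun t _ => (hderiv t).continuousAt.continuousWithinAt)
      (fun t _ => (hderiv t).differentiableAt.differentiableWithinAt) fun t ht => ?_
    rw [interior_Icc] at ht
    rw [(hderiv t).deriv]
    have h := hq (t • η) (hη.const_smul t)
    simp only [hη.jac_const_smul, mdot_smul_right, ← fderiv_apply_eq_mdot_gradx] at h
    rw [integral_const_mul] at h
    exact nonneg_of_mul_nonneg_right h ht.1
  have h := hmono (Set.left_mem_Icc.2 zero_le_one) (Set.right_mem_Icc.2 zero_le_one) zero_le_one
  simpa [measureReal_def, mul_comm] using h

end Quasiconvex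

section Gradient

variable {n N : ℕ}

lemma continuous_gradx {f : (Fin n → ℝ) → (Fin N → Fin n → ℝ) → ℝ} {x : Fin n → ℝ}
    (hf : ContDiff ℝ 1 (f x)) : Continuous (gradx f x) := by
  have : Continuous (fderiv ℝ (f x)) := hf.continuous_fderiv (by simp)
  unfold gradx
  fun_prop

lemma measurable_indicator_gradx {f : (Fin n → ℝ) → (Fin N → Fin n → ℝ) → ℝ}
    (hf : ∀ ξ, Measurable fun x => f x ξ) {S : Set (Fin n → ℝ)} (hS : MeasurableSet S)
    (hC : ∀ x ∈ S, ContDiff ℝ 1 (f x)) (ξ : Fin N → Fin n → ℝ) :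
    Measurable (S.indicator fun x => gradx f x ξ) := by
  refine measurable_pi_iff.2 fun i => measurable_pi_iff.2 fun j => ?_
  refine measurable_of_tendsto_metrizable (f := fun (k : ℕ) => S.indicator fun x =>
    (k : ℝ) • (f x (ξ + (k : ℝ)⁻¹ • eMat i j) - f x ξ)) (fun k => ?_) ?_
  · exact (((hf _).sub (hf ξ)).const_smul (k : ℝ)).indicator hS
  · refine tendsto_pi_nhds.2 fun x => ?_
    by_cases hx : x ∈ S
    · simp only [Set.indicator_of_mem hx]
      have hd := ((hC x hx).differentiable (by simp) ξ).hasFDerivAt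
      refine hd.lim (eMat i j) (c := fun k : ℕ => (k : ℝ)) ?_
      simpa using tendsto_natCast_atTop_atTop (R := ℝ)
    · simp [hx]

end Gradient

/-- If `f(x, ·)` is `C¹` for a.e. `x` with the stated growth of
`D_ξ f`, and `D_ξ f` is integrally monotone on `Ω`, then for a.e. `x₀ ∈ Ω` the map
`D_ξ f(x₀, ·)` is quasimonotone, and consequently `f(x₀, ·)` is quasiconvex. -/
theorem integral_monotone_implies_ae_quasimonotone_quasiconvex
    {N n : ℕ} (hN : 0 < N) (hn : 0 < n)
    (Ω : Set (Fin n → ℝ)) (hΩo : IsOpen Ω) (hΩne : Ω.Nonempty)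
    (hΩb : Bornology.IsBounded Ω)
    (f : (Fin n → ℝ) → (Fin N → Fin n → ℝ) → ℝ)
    (hmeas : ∀ ξ : Fin N → Fin n → ℝ, Measurable fun x => f x ξ)
    (hC1 : ∀ᵐ x ∂(volume.restrict Ω), ContDiff ℝ 1 (f x))
    (c₂ : (Fin n → ℝ) → ℝ) (c₃ : (Fin N → Fin n → ℝ) → ℝ)
    (hc₂0 : ∀ x, 0 ≤ c₂ x) (hc₂int : IntegrableOn c₂ Ω)
    (hc₃0 : ∀ ξ, 0 ≤ c₃ ξ) (hc₃cont : Continuous c₃)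
    (hgrowth : ∀ᵐ x ∂(volume.restrict Ω), ∀ ξ : Fin N → Fin n → ℝ,
      Real.sqrt (mdot (gradx f x ξ) (gradx f x ξ)) ≤ c₂ x + c₃ ξ)
    (hmono : ∀ φ ψ : (Fin n → ℝ) → Fin N → ℝ, TestMap Ω φ → TestMap Ω ψ →
      0 ≤ ∫ x in Ω,
        mdot (gradx f x (jac ψ x + jac φ x) - gradx f x (jac ψ x)) (jac φ x)) :
    ∀ᵐ x₀ ∂(volume.restrict Ω),
      (∀ G : Set (Fin n → ℝ), IsOpen G → G.Nonempty → Bornology.IsBounded G →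
        ∀ ξ : Fin N → Fin n → ℝ, ∀ η : (Fin n → ℝ) → Fin N → ℝ, TestMap G η →
          0 ≤ ∫ y in G, mdot (gradx f x₀ (ξ + jac η y)) (jac η y)) ∧
      (∀ G : Set (Fin n → ℝ), IsOpen G → G.Nonempty → Bornology.IsBounded G →
        ∀ ξ : Fin N → Fin n → ℝ, ∀ η : (Fin n → ℝ) → Fin N → ℝ, TestMap G η →
          f x₀ ξ * (volume G).toReal ≤ ∫ y in G, f x₀ (ξ + jac η y)) := by
  obtain ⟨S, hSae, hSm, hS⟩ := (hC1.and hgrowth).exists_measurable_mem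
  let T := S ∩ Ω
  have hTm : MeasurableSet T := hSm.inter hΩo.measurableSet
  let F : (Fin n → ℝ) → (Fin N → Fin n → ℝ) → Fin N → Fin n → ℝ :=
    fun x ξ => T.indicator (fun x => gradx f x ξ) x
  have hFT : ∀ x ∈ T, F x = gradx f x := fun x hx => by
    ext1 ξ
    exact Set.indicator_of_mem hx _
  have hF0 : ∀ x ∉ T, F x = 0 := fun x hx => by
    ext1 ξ
    exact Set.indicator_of_notMem hx _
  have hTae : ∀ᵐ x ∂(volume.restrict Ω), x ∈ T :=
    (mem_of_superset (inter_mem hSae (ae_restrict_mem hΩo.measurableSet)) fun _ h => h)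
  have hcont : ∀ x, Continuous (F x) := fun x => by
    by_cases hx : x ∈ T
    · rw [hFT x hx]
      exact continuous_gradx (hS x hx.1).1
    · rw [hF0 x hx]
      exact continuous_zero
  have hFmeas : ∀ ξ, Measurable fun x => F x ξ :=
    measurable_indicator_gradx hmeas hTm fun x hx => (hS x hx.1).1
  have hFmono : ∀ φ ψ : (Fin n → ℝ) → Fin N → ℝ, TestMap Ω φ → TestMap Ω ψ →
      0 ≤ ∫ x in Ω, mdot (F x (jac ψ x + jac φ x) - F x (jac ψ x)) (jac φ x) := by
    intro φ ψ hφ hψ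
    refine (hmono φ ψ hφ hψ).trans_eq (integral_congr_ae ?_)
    filter_upwards [hTae] with x hx
    rw [hFT x hx]
  have hbound : ∀ x ξ, ‖F x ξ‖ ≤ Ω.indicator c₂ x + c₃ ξ := by
    intro x ξ
    by_cases hx : x ∈ T
    · rw [hFT x hx, Set.indicator_of_mem hx.2]
      exact (norm_le_sqrt_mdot_self _).trans ((hS x hx.1).2 ξ)
    · rw [hF0 x hx, Pi.zero_apply, norm_zero]
      exact add_nonneg (Set.indicator_nonneg (fun x _ => hc₂0 x) x) (hc₃0 ξ)
  have hLeb := ae_exists_modulus_tendsto_average F hcont hFmeas (Ω.indicator c₂)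
    ((integrable_indicator_iff hΩo.measurableSet).2 hc₂int) c₃ hc₃cont hbound
  filter_upwards [hTae, ae_restrict_of_ae hLeb] with x₀ hx₀ hD
  have hqm : ∀ (G : Set (Fin n → ℝ)) (ξ : Fin N → Fin n → ℝ) (η : (Fin n → ℝ) → Fin N → ℝ),
      TestMap G η → 0 ≤ ∫ y in G, mdot (gradx f x₀ (ξ + jac η y)) (jac η y) := by
    intro G ξ η hη
    have h := quasimonotone_of_modulus_tendsto_average hΩo F hcont hFmeas hFmono hx₀.2 hD hη ξ
    rw [hFT x₀ hx₀] at h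
    rwa [setIntegral_eq_integral_of_forall_compl_eq_zero]
    intro y hy
    rw [hη.jac_eq_zero hy, mdot_zero_right]
  exact ⟨fun G _ _ _ ξ η hη => hqm G ξ η hη, fun G _ _ hGb ξ η hη =>
    quasiconvex_of_quasimonotone f x₀ (hS x₀ hx₀.1).1 hGb ξ (hqm G ξ) hη⟩
end
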